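/- Set λ = (h1+h2+h3+h4−l1−l2−l3−l4+3)/2 and assume n := −λ+1/2 is a non-negative integer. Let V² be the complex vector space of functions on (0,∞) spanned by the monomials x ↦ x^{λ+k} for k = 0, 1, …, n (the top monomial being x^{1/2}). Then the operator A² preserves V², i.e., A² g ∈ V² for every g ∈ V². -/

import Mathlib

noncomputable def qp (q r : ℝ) : ℂ := ((q ^ r : ℝ) : ℂ)

noncomputable def A2 (q h1 h2 h3 h4 l1 l2 l3 l4 : ℝ) (t1 t2 t3 t4 : ℂ) (g : ℝ → ℂ) (x : ℝ) : ℂ :=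
  ((x : ℂ) ^ 2)⁻¹ * ((x : ℂ) - qp q (h1 + 1/2) * t1) * ((x : ℂ) - qp q (h2 + 1/2) * t2)
      * ((x : ℂ) - qp q (h3 + 1/2) * t3) * ((x : ℂ) - qp q (h4 + 1/2) * t4) * g (x / q)
    + ((x : ℂ) ^ 2)⁻¹ * ((x : ℂ) - qp q (l1 - 1/2) * t1) * ((x : ℂ) - qp q (l2 - 1/2) * t2)
      * ((x : ℂ) - qp q (l3 - 1/2) * t3) * ((x : ℂ) - qp q (l4 - 1/2) * t4) * g (q * x)
    + (-(qp q (1/2) + qp q (-(1/2))) * (x : ℂ) ^ 2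
        + ((qp q h1 + qp q l1) * t1 + (qp q h2 + qp q l2) * t2 + (qp q h3 + qp q l3) * t3
            + (qp q h4 + qp q l4) * t4) * (x : ℂ)
        + qp q ((h1 + l1) / 2) * t1 * (qp q ((h2 + l2) / 2) * t2) * (qp q ((h3 + l3) / 2) * t3)
          * (qp q ((h4 + l4) / 2) * t4)
          * (-(qp q (1/2) + qp q (-(1/2))) * ((x : ℂ) ^ 2)⁻¹
              + (qp q (-h1) * t1⁻¹ + qp q (-l1) * t1⁻¹ + qp q (-h2) * t2⁻¹ + qp q (-l2) * t2⁻¹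
                  + qp q (-h3) * t3⁻¹ + qp q (-l3) * t3⁻¹ + qp q (-h4) * t4⁻¹ + qp q (-l4) * t4⁻¹)
                * (x : ℂ)⁻¹)) * g x

/-- Coefficients of the expansion of the operator on a monomial, in abstract form. -/
theorem expand_aux (X G u v p1 p2 p3 p4 r1 r2 r3 r4 c S W T : ℂ) (hX : X ≠ 0) :
    (X ^ 2)⁻¹ * (X - p1) * (X - p2) * (X - p3) * (X - p4) * (G * v)
    + (X ^ 2)⁻¹ * (X - r1) * (X - r2) * (X - r3) * (X - r4) * (G * u)
    + (-c * X ^ 2 + S * X + W * (-c * (X ^ 2)⁻¹ + T * X⁻¹)) * G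
    = (v + u - c) * (G * X ^ 2)
      + (-(p1 + p2 + p3 + p4) * v - (r1 + r2 + r3 + r4) * u + S) * (G * X)
      + ((p1*p2+p1*p3+p1*p4+p2*p3+p2*p4+p3*p4) * v
          + (r1*r2+r1*r3+r1*r4+r2*r3+r2*r4+r3*r4) * u) * G
      + (-(p1*p2*p3+p1*p2*p4+p1*p3*p4+p2*p3*p4) * v
          - (r1*r2*r3+r1*r2*r4+r1*r3*r4+r2*r3*r4) * u + W * T) * (G * X⁻¹)
      + (p1*p2*p3*p4 * v + r1*r2*r3*r4 * u - W * c) * (G * (X ^ 2)⁻¹) := by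
  field_simp
  ring

theorem qp_add (q : ℝ) (hq : 0 < q) (a b : ℝ) : qp q (a + b) = qp q a * qp q b := by
  simp [qp, Real.rpow_add hq]

theorem qp_neg (q : ℝ) (hq : 0 < q) (a : ℝ) : qp q (-a) = (qp q a)⁻¹ := by
  simp [qp, Real.rpow_neg hq.le]

theorem qp_ne (q : ℝ) (hq : 0 < q) (a : ℝ) : qp q a ≠ 0 := by
  simpa [qp] using (Real.rpow_pos_of_pos hq a).ne'

theorem qp_two (q : ℝ) (hq : 0 < q) (a : ℝ) : qp q a = qp q (a / 2) ^ 2 := by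
  rw [pow_two, ← qp_add q hq]; congr 1; ring

theorem qp_sub (q : ℝ) (hq : 0 < q) (a b : ℝ) : qp q (a - b) = qp q a * (qp q b)⁻¹ := by
  rw [sub_eq_add_neg, qp_add q hq, qp_neg q hq]

theorem stmt13 (q h1 h2 h3 h4 l1 l2 l3 l4 : ℝ) (hq : 0 < q) (hq1 : q ≠ 1)
    (t1 t2 t3 t4 : ℂ) (ht1 : t1 ≠ 0) (ht2 : t2 ≠ 0) (ht3 : t3 ≠ 0) (ht4 : t4 ≠ 0)
    (lam : ℝ)
    (hlam : lam = (h1 + h2 + h3 + h4 - l1 - l2 - l3 - l4 + 3) / 2)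
    (n : ℕ) (hn : (n : ℝ) = -lam + 1/2)
    (V : Submodule ℂ (ℝ → ℂ))
    (hV : V = Submodule.span ℂ
      {f : ℝ → ℂ | ∃ k : ℕ, k ≤ n ∧ f = fun x : ℝ => ((x ^ (lam + (k : ℝ)) : ℝ) : ℂ)})
    (g : ℝ → ℂ) (hg : g ∈ V) :
    ∃ f ∈ V, ∀ x : ℝ, 0 < x → A2 q h1 h2 h3 h4 l1 l2 l3 l4 t1 t2 t3 t4 g x = f x := by
  have hqadd := qp_add q hq
  have hqneg := qp_neg q hq
  have hqsub := qp_sub q hq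
  have mem : ∀ (c : ℂ) (m : ℤ), ((0 ≤ m ∧ m ≤ n) ∨ c = 0) →
      (fun x : ℝ => c * ((x ^ (lam + (m : ℝ)) : ℝ) : ℂ)) ∈ V := by
    rintro c m (⟨h0, h1⟩ | rfl)
    · obtain ⟨k, rfl⟩ := Int.eq_ofNat_of_zero_le h0
      have : (fun x : ℝ => c * ((x ^ (lam + (((k : ℕ) : ℤ) : ℝ)) : ℝ) : ℂ))
          = c • (fun x : ℝ => ((x ^ (lam + (k : ℝ)) : ℝ) : ℂ)) := by
        ext x; simp
      rw [this, hV]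
      exact Submodule.smul_mem _ c (Submodule.subset_span ⟨k, by exact_mod_cast h1, rfl⟩)
    · simp only [zero_mul]; exact V.zero_mem
  have hlamn : lam = 1/2 - n := by linarith
  -- values of `qp` in terms of square roots
  have hs : qp q (1/2) ≠ 0 := qp_ne q hq _
  have ha1 := qp_ne q hq (h1/2)
  have ha2 := qp_ne q hq (h2/2)
  have ha3 := qp_ne q hq (h3/2)
  have ha4 := qp_ne q hq (h4/2)
  have hb1 := qp_ne q hq (l1/2)
  have hb2 := qp_ne q hq (l2/2)
  have hb3 := qp_ne q hq (l3/2)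
  have hb4 := qp_ne q hq (l4/2)
  have hL : qp q lam = qp q (h1/2) * qp q (h2/2) * qp q (h3/2) * qp q (h4/2)
      * (qp q (l1/2))⁻¹ * (qp q (l2/2))⁻¹ * (qp q (l3/2))⁻¹ * (qp q (l4/2))⁻¹
      * (qp q (1/2)) ^ 3 := by
    simp only [← hqneg, ← hqadd, pow_succ, pow_zero, one_mul]
    congr 1; rw [hlam]; ring
  have hone : qp q 1 = qp q (1/2) ^ 2 := qp_two q hq 1
  have hbasis : ∀ k : ℕ, k ≤ n → ∃ f ∈ V, ∀ x : ℝ, 0 < x →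
      A2 q h1 h2 h3 h4 l1 l2 l3 l4 t1 t2 t3 t4
        (fun x : ℝ => ((x ^ (lam + (k : ℝ)) : ℝ) : ℂ)) x = f x := by
    intro k hk
    have E := fun (x : ℝ) (hx : 0 < x) => expand_aux (x : ℂ) (((x ^ (lam + (k : ℝ)) : ℝ) : ℂ))
      (qp q (lam + k)) (qp q (-(lam + k)))
      (qp q (h1 + 1/2) * t1) (qp q (h2 + 1/2) * t2) (qp q (h3 + 1/2) * t3) (qp q (h4 + 1/2) * t4)
      (qp q (l1 - 1/2) * t1) (qp q (l2 - 1/2) * t2) (qp q (l3 - 1/2) * t3) (qp q (l4 - 1/2) * t4)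
      (qp q (1/2) + qp q (-(1/2)))
      ((qp q h1 + qp q l1) * t1 + (qp q h2 + qp q l2) * t2 + (qp q h3 + qp q l3) * t3
            + (qp q h4 + qp q l4) * t4)
      (qp q ((h1 + l1) / 2) * t1 * (qp q ((h2 + l2) / 2) * t2) * (qp q ((h3 + l3) / 2) * t3)
          * (qp q ((h4 + l4) / 2) * t4))
      (qp q (-h1) * t1⁻¹ + qp q (-l1) * t1⁻¹ + qp q (-h2) * t2⁻¹ + qp q (-l2) * t2⁻¹
                  + qp q (-h3) * t3⁻¹ + qp q (-l3) * t3⁻¹ + qp q (-h4) * t4⁻¹ + qp q (-l4) * t4⁻¹)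
      (by exact_mod_cast hx.ne')
    refine ⟨_, V.add_mem (V.add_mem (V.add_mem (V.add_mem
      (mem (qp q (-(lam + k)) + qp q (lam + k) - (qp q (1/2) + qp q (-(1/2)))) (k + 2) ?m2) (mem (-((qp q (h1 + 1/2) * t1)
        + (qp q (h2 + 1/2) * t2)
        + (qp q (h3 + 1/2) * t3)
        + (qp q (h4 + 1/2) * t4)) * qp q (-(lam + k))
      - ((qp q (l1 - 1/2) * t1)
        + (qp q (l2 - 1/2) * t2)
        + (qp q (l3 - 1/2) * t3)
        + (qp q (l4 - 1/2) * t4)) * qp q (lam + k)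
      + (((qp q h1 + qp q l1) * t1 + (qp q h2 + qp q l2) * t2 + (qp q h3 + qp q l3) * t3
            + (qp q h4 + qp q l4) * t4))) (k + 1) ?m1)) (mem (((qp q (h1 + 1/2) * t1) * (qp q (h2 + 1/2) * t2)
        + (qp q (h1 + 1/2) * t1) * (qp q (h3 + 1/2) * t3)
        + (qp q (h1 + 1/2) * t1) * (qp q (h4 + 1/2) * t4)
        + (qp q (h2 + 1/2) * t2) * (qp q (h3 + 1/2) * t3)
        + (qp q (h2 + 1/2) * t2) * (qp q (h4 + 1/2) * t4)
        + (qp q (h3 + 1/2) * t3) * (qp q (h4 + 1/2) * t4)) * qp q (-(lam + k))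
      + ((qp q (l1 - 1/2) * t1) * (qp q (l2 - 1/2) * t2)
        + (qp q (l1 - 1/2) * t1) * (qp q (l3 - 1/2) * t3)
        + (qp q (l1 - 1/2) * t1) * (qp q (l4 - 1/2) * t4)
        + (qp q (l2 - 1/2) * t2) * (qp q (l3 - 1/2) * t3)
        + (qp q (l2 - 1/2) * t2) * (qp q (l4 - 1/2) * t4)
        + (qp q (l3 - 1/2) * t3) * (qp q (l4 - 1/2) * t4)) * qp q (lam + k)) k ?m0))
      (mem (-((qp q (h1 + 1/2) * t1) * (qp q (h2 + 1/2) * t2) * (qp q (h3 + 1/2) * t3)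
        + (qp q (h1 + 1/2) * t1) * (qp q (h2 + 1/2) * t2) * (qp q (h4 + 1/2) * t4)
        + (qp q (h1 + 1/2) * t1) * (qp q (h3 + 1/2) * t3) * (qp q (h4 + 1/2) * t4)
        + (qp q (h2 + 1/2) * t2) * (qp q (h3 + 1/2) * t3) * (qp q (h4 + 1/2) * t4)) * qp q (-(lam + k))
      - ((qp q (l1 - 1/2) * t1) * (qp q (l2 - 1/2) * t2) * (qp q (l3 - 1/2) * t3)
        + (qp q (l1 - 1/2) * t1) * (qp q (l2 - 1/2) * t2) * (qp q (l4 - 1/2) * t4)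
        + (qp q (l1 - 1/2) * t1) * (qp q (l3 - 1/2) * t3) * (qp q (l4 - 1/2) * t4)
        + (qp q (l2 - 1/2) * t2) * (qp q (l3 - 1/2) * t3) * (qp q (l4 - 1/2) * t4)) * qp q (lam + k)
      + (qp q ((h1 + l1) / 2) * t1 * (qp q ((h2 + l2) / 2) * t2) * (qp q ((h3 + l3) / 2) * t3)
          * (qp q ((h4 + l4) / 2) * t4)) * (qp q (-h1) * t1⁻¹ + qp q (-l1) * t1⁻¹ + qp q (-h2) * t2⁻¹ + qp q (-l2) * t2⁻¹
                  + qp q (-h3) * t3⁻¹ + qp q (-l3) * t3⁻¹ + qp q (-h4) * t4⁻¹ + qp q (-l4) * t4⁻¹)) (k - 1) ?n1)) (mem (((qp q (h1 + 1/2) * t1) * (qp q (h2 + 1/2) * t2) * (qp q (h3 + 1/2) * t3) * (qp q (h4 + 1/2) * t4)) * qp q (-(lam + k))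
      + ((qp q (l1 - 1/2) * t1) * (qp q (l2 - 1/2) * t2) * (qp q (l3 - 1/2) * t3) * (qp q (l4 - 1/2) * t4)) * qp q (lam + k)
      - (qp q ((h1 + l1) / 2) * t1 * (qp q ((h2 + l2) / 2) * t2) * (qp q ((h3 + l3) / 2) * t3)
          * (qp q ((h4 + l4) / 2) * t4)) * (qp q (1/2) + qp q (-(1/2)))) (k - 2) ?n2), fun x hx => ?_⟩
    case m0 => left; constructor <;> omega
    case m1 =>
      by_cases hkn : k = n
      · right
        have : lam + k = 1/2 := by rw [hkn]; linarith
        rw [this]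
        simp only [hqadd, hqneg, hqsub]
        field_simp
        ring
      · left; constructor <;> omega
    case m2 =>
      by_cases hkn : k = n
      · right
        have : lam + k = 1/2 := by rw [hkn]; linarith
        rw [this]
        ring
      by_cases hkn : k + 1 = n
      · right
        have : lam + k = -(1/2) := by rw [← hkn] at hlamn; push_cast at hlamn; linarith
        rw [this, neg_neg]
        ring
      · left; constructor <;> omega
    case n1 =>
      by_cases hk0 : k = 0
      · right
        subst hk0
        simp only [add_div, Nat.cast_zero, add_zero, hqneg, hqadd, hqsub, hL]
        rw [qp_two q hq h1, qp_two q hq h2, qp_two q hq h3, qp_two q hq h4,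
          qp_two q hq l1, qp_two q hq l2, qp_two q hq l3, qp_two q hq l4]
        field_simp
        ring
      · left; constructor <;> omega
    case n2 =>
      by_cases hk0 : k = 0
      · right
        subst hk0
        simp only [add_div, Nat.cast_zero, add_zero, hqneg, hqadd, hqsub, hL]
        rw [qp_two q hq h1, qp_two q hq h2, qp_two q hq h3, qp_two q hq h4,
          qp_two q hq l1, qp_two q hq l2, qp_two q hq l3, qp_two q hq l4]
        field_simp
        ring
      by_cases hk1 : k = 1
      · right
        subst hk1
        simp only [add_div, Nat.cast_one, hqneg, hqadd, hqsub, hL, hone]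
        rw [qp_two q hq h1, qp_two q hq h2, qp_two q hq h3, qp_two q hq h4,
          qp_two q hq l1, qp_two q hq l2, qp_two q hq l3, qp_two q hq l4]
        field_simp
        ring
      · left; constructor <;> omega
    · skip
      have e1 : (x / q) ^ (lam + (k : ℝ)) = x ^ (lam + (k : ℝ)) * q ^ (-(lam + (k : ℝ))) := by
        rw [Real.div_rpow hx.le hq.le, Real.rpow_neg hq.le]; rfl
      have e2 : (q * x) ^ (lam + (k : ℝ)) = x ^ (lam + (k : ℝ)) * q ^ (lam + (k : ℝ)) := by
        rw [Real.mul_rpow hq.le hx.le, mul_comm]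
      have f2 : x ^ (lam + ((k + 2 : ℤ) : ℝ)) = x ^ (lam + (k : ℝ)) * x ^ 2 := by
        rw [← Real.rpow_natCast x 2, ← Real.rpow_add hx]; push_cast; congr 1; ring
      have f1 : x ^ (lam + ((k + 1 : ℤ) : ℝ)) = x ^ (lam + (k : ℝ)) * x := by
        rw [← Real.rpow_add_one hx.ne']; push_cast; congr 1; ring
      have f3 : x ^ (lam + ((k - 1 : ℤ) : ℝ)) = x ^ (lam + (k : ℝ)) * x⁻¹ := by
        rw [← Real.rpow_neg_one x, ← Real.rpow_add hx]; push_cast; congr 1; ring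
      have f4 : x ^ (lam + ((k - 2 : ℤ) : ℝ)) = x ^ (lam + (k : ℝ)) * (x ^ 2)⁻¹ := by
        rw [← Real.rpow_natCast x 2, ← Real.rpow_neg hx.le, ← Real.rpow_add hx]
        push_cast; congr 1; ring
      simp only [Pi.add_apply, f1, f2, f3, f4]
      simp only [A2, e1, e2]
      have E' := E x hx
      simp only [qp] at E' ⊢
      push_cast at E' ⊢
      exact E'
  have hg' := hg
  rw [hV] at hg'
  clear hg
  induction hg' using Submodule.span_induction with
  | mem f hf =>
    obtain ⟨k, hk, rfl⟩ := hf
    exact hbasis k hk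
  | zero => exact ⟨0, V.zero_mem, fun x _ => by simp [A2]⟩
  | add f1 f2 _ _ i1 i2 =>
    obtain ⟨u, hu, eu⟩ := i1
    obtain ⟨v, hv, ev⟩ := i2
    refine ⟨u + v, V.add_mem hu hv, fun x hx => ?_⟩
    rw [Pi.add_apply, ← eu x hx, ← ev x hx]
    simp only [A2, Pi.add_apply]
    ring
  | smul c f _ i =>
    obtain ⟨u, hu, eu⟩ := i
    refine ⟨c • u, V.smul_mem c hu, fun x hx => ?_⟩
    rw [Pi.smul_apply, ← eu x hx]
    simp only [A2, Pi.smul_apply, smul_eq_mul]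
    ring
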